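/- Let {X_j} be a decreasing sequence of compact sets contained in a closed ball B of C^n, let X be the intersection of all X_j, and let z_j be a point of X_j and mu_j a measure in J_{z_j}(X_j) for each j. If some subsequence of {mu_j} converges weak-* (as functionals on C(B)) to a measure mu and the corresponding subsequence of {z_j} converges to a point z_0, then mu belongs to J_{z_0}(X). -/

import Mathlib

open MeasureTheory Metric Filter Topology Set Complex
open scoped ENNReal

noncomputable section

/-- `ℂⁿ`. -/
abbrev En (n : ℕ) : Type := EuclideanSpace ℂ (Fin n)

instance (n : ℕ) : MeasurableSpace (En n) := borel _

instance (n : ℕ) : BorelSpace (En n) := ⟨rfl⟩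

open Classical in
/-- The positive part of an extended real number, as an element of `ℝ≥0∞`. -/
def epos (x : EReal) : ℝ≥0∞ := if x = ⊤ then ⊤ else ENNReal.ofReal x.toReal

/-- The integral of an `EReal`-valued function `u` against a measure `μ`, defined as the
difference of the lower integrals of the positive and negative parts of `u`. -/
def eint {α : Type*} [MeasurableSpace α] (μ : Measure α) (u : α → EReal) : EReal :=
  ((∫⁻ x, epos (u x) ∂μ : ℝ≥0∞) : EReal) - ((∫⁻ x, epos (-(u x)) ∂μ : ℝ≥0∞) : EReal)

/-- The normalized angular measure `(2π)⁻¹ dθ` on `[0, 2π)`. -/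
def thetaM : Measure ℝ :=
  (ENNReal.ofReal ((2 * Real.pi)⁻¹)) • (volume.restrict (Set.Ico (0 : ℝ) (2 * Real.pi)))

/-- A function `u` with values in `[-∞, ∞)` is plurisubharmonic on an open set `U ⊆ ℂⁿ`:
it is upper semicontinuous, `< ⊤`, and satisfies the sub-mean-value inequality on every
complex line. -/
def PshOnE {n : ℕ} (u : En n → EReal) (U : Set (En n)) : Prop :=
  UpperSemicontinuousOn u U ∧ (∀ z ∈ U, u z < ⊤) ∧
  ∀ z ∈ U, ∀ w : En n, ∀ r : ℝ, 0 < r →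
    (∀ ζ : ℂ, ‖ζ‖ ≤ r → z + ζ • w ∈ U) →
    u z ≤ eint thetaM (fun θ => u (z + (circleMap 0 r θ) • w))

/-- `μ` is a Jensen measure on `X` with barycenter `z`:  a Borel probability measure
supported on `X` such that `u z ≤ ∫ u dμ` for every function `u` continuous and
plurisubharmonic on some open neighborhood of `X`. -/
def IsJensen {n : ℕ} (X : Set (En n)) (z : En n) (μ : Measure (En n)) : Prop :=
  IsProbabilityMeasure μ ∧ μ Xᶜ = 0 ∧
  ∀ U : Set (En n), IsOpen U → X ⊆ U →
    ∀ u : En n → EReal, ContinuousOn u U → PshOnE u U → u z ≤ eint μ u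

/-- `u : X → [-∞, ∞)` is plurisubharmonic on the compact set `X` : it is upper
semicontinuous on `X`, `< ⊤` on `X`, and satisfies the subaveraging inequality with respect
to all Jensen measures on `X`. -/
def PSHe {n : ℕ} (X : Set (En n)) (u : En n → EReal) : Prop :=
  UpperSemicontinuousOn u X ∧ (∀ z ∈ X, u z < ⊤) ∧
  ∀ z ∈ X, ∀ μ : Measure (En n), IsJensen X z μ → u z ≤ eint μ u

/-- `PSH^c(X)`: continuous plurisubharmonic functions on `X`. -/
def PSHce {n : ℕ} (X : Set (En n)) (u : En n → EReal) : Prop :=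
  PSHe X u ∧ ContinuousOn u X

/-- Real-valued continuous plurisubharmonic functions on `X`. -/
def PSHcR {n : ℕ} (X : Set (En n)) (u : En n → ℝ) : Prop :=
  ContinuousOn u X ∧ PSHe X (fun x => (u x : EReal))

/-- `O_X`: the set of points `z ∈ X` whose only Jensen measure is `δ_z`. -/
def Oset {n : ℕ} (X : Set (En n)) : Set (En n) :=
  {z | z ∈ X ∧ ∀ μ : Measure (En n), IsJensen X z μ → μ = Measure.dirac z}

/-- The potential boundary `B_X`, the closure of `O_X`. -/
def Bset {n : ℕ} (X : Set (En n)) : Set (En n) := closure (Oset X)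

/-- `J^b_z(X)`: Jensen measures with barycenter `z` supported on `B_X`. -/
def IsJensenB {n : ℕ} (X : Set (En n)) (z : En n) (μ : Measure (En n)) : Prop :=
  IsJensen X z μ ∧ μ (Bset X)ᶜ = 0

/-- `ν` is subordinated to `μ` : `μ(u) ≥ ν(u)` for all `u ∈ PSH^c(X)`. -/
def Subord {n : ℕ} (X : Set (En n)) (μ ν : Measure (En n)) : Prop :=
  ∀ u : En n → EReal, PSHce X u → eint ν u ≤ eint μ u

/-- Subharmonic functions with values in `[-∞, ∞)` on an open set `U ⊆ ℂ`. -/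
def SubharmOn (u : ℂ → EReal) (U : Set ℂ) : Prop :=
  UpperSemicontinuousOn u U ∧ (∀ z ∈ U, u z < ⊤) ∧
  ∀ z ∈ U, ∀ r : ℝ, 0 < r → closedBall z r ⊆ U →
    u z ≤ eint thetaM (fun θ => u (circleMap z r θ))

/-- Harmonic (real-valued) functions on an open set `U ⊆ ℂ`: continuous functions
satisfying the mean-value equality. -/
def HarmOn (h : ℂ → ℝ) (U : Set ℂ) : Prop :=
  ContinuousOn h U ∧
  ∀ z ∈ U, ∀ r : ℝ, 0 < r → closedBall z r ⊆ U →
    h z = (2 * Real.pi)⁻¹ * ∫ θ in (0 : ℝ)..(2 * Real.pi), h (circleMap z r θ)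

/-- Superharmonic (real-valued) functions on an open set `U ⊆ ℂ`. -/
def SuperharmOn (v : ℂ → ℝ) (U : Set ℂ) : Prop :=
  LowerSemicontinuousOn v U ∧
  ∀ z ∈ U, ∀ r : ℝ, 0 < r → closedBall z r ⊆ U →
    (2 * Real.pi)⁻¹ * (∫ θ in (0 : ℝ)..(2 * Real.pi), v (circleMap z r θ)) ≤ v z

/-- The infimum of all positive superharmonic functions on the unit disk, extending
continuously to the closed disk and `≥ 1` on `A`, evaluated at `z`. -/
def hmPre (A : Set ℂ) (z : ℂ) : ℝ :=
  sInf {t : ℝ | ∃ v : ℂ → ℝ, SuperharmOn v (ball 0 1) ∧ (∀ w ∈ ball (0 : ℂ) 1, 0 < v w) ∧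
    ContinuousOn v (closedBall 0 1) ∧ (∀ w ∈ A, 1 ≤ v w) ∧ t = v z}

/-- The harmonic measure `ω(z, A, 𝔻)` of `A` with respect to the unit disk. -/
def hm (z : ℂ) (A : Set ℂ) : ℝ := Filter.liminf (fun w => hmPre A w) (𝓝 z)

open Classical in
/-- The radial limit of a map `f` at the boundary point `ζ` of the unit circle
(junk value `0` if the radial limit does not exist). -/
def bval {n : ℕ} (f : ℂ → En n) (ζ : ℂ) : En n :=
  if h : ∃ l : En n, Tendsto (fun r : ℝ => f ((r : ℂ) * ζ)) (𝓝[<] (1 : ℝ)) (𝓝 l)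
  then h.choose else 0

open Classical in
/-- The radial limit of an `EReal`-valued function on the disk at the boundary point `ζ`. -/
def bvalE (g : ℂ → EReal) (ζ : ℂ) : EReal :=
  if h : ∃ l : EReal, Tendsto (fun r : ℝ => g ((r : ℂ) * ζ)) (𝓝[<] (1 : ℝ)) (𝓝 l)
  then h.choose else 0

/-- `μ_f`: the push-forward of the normalized arclength measure on the unit circle under the
radial boundary values of `f`. -/
def bmeas {n : ℕ} (f : ℂ → En n) : Measure (En n) :=
  thetaM.map (fun θ => bval f (circleMap 0 1 θ))

/-- Weak-* convergence of a sequence of measures on `ℂⁿ`. -/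
def WeakConv {n : ℕ} (μs : ℕ → Measure (En n)) (μ : Measure (En n)) : Prop :=
  ∀ φ : BoundedContinuousFunction (En n) ℝ,
    Tendsto (fun j => ∫ x, φ x ∂(μs j)) atTop (𝓝 (∫ x, φ x ∂μ))

/-- The cluster set `cl L` of a sequence of maps of the unit disk into `ℂⁿ`. -/
def clusterSet {n : ℕ} (f : ℕ → ℂ → En n) : Set (En n) :=
  {z | ∀ r : ℝ, 0 < r → ∀ N : ℕ, ∃ j, N ≤ j ∧ ∃ ζ ∈ ball (0 : ℂ) 1, f j ζ ∈ ball z r}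

/-- A point `z` is totally essential for the sequence `f` if for every open set `V ∋ z` the
harmonic measures at `0` of `f j ⁻¹' V` stay bounded away from `0`. -/
def TotallyEssential {n : ℕ} (f : ℕ → ℂ → En n) (z : En n) : Prop :=
  ∀ V : Set (En n), IsOpen V → z ∈ V →
    0 < Filter.atTop.liminf (fun j => hm 0 ((f j ⁻¹' V) ∩ ball 0 1))

/-- A totally perfect sequence `L` of holomorphic maps of the unit disk into `ℂⁿ`: a
uniformly bounded sequence of holomorphic maps which is weak-* converging (with limit measure
`μ_L` and center `z_L`) and all of whose cluster points are totally essential. -/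
structure PerfectSeq (n : ℕ) where
  f : ℕ → ℂ → En n
  holo : ∀ j, DifferentiableOn ℂ (f j) (ball 0 1)
  bdd : ∃ C : ℝ, ∀ j, ∀ ζ ∈ ball (0 : ℂ) 1, ‖f j ζ‖ ≤ C
  μL : Measure (En n)
  conv : WeakConv (fun j => bmeas (f j)) μL
  zL : En n
  center : Tendsto (fun j => f j 0) atTop (𝓝 zL)
  ess : ∀ z ∈ clusterSet f, TotallyEssential f z

/-- `J_z^s(L)`: the measures obtained as weak-* limits of `μ_{f_{j_k} ∘ g_k}` for subsequences
`{j_k}` and holomorphic maps `g_k : 𝔻 → 𝔻` with `f_{j_k}(g_k(0)) → z`. -/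
def JsSet {n : ℕ} (L : PerfectSeq n) (z : En n) : Set (Measure (En n)) :=
  {μ | ∃ jk : ℕ → ℕ, StrictMono jk ∧ ∃ g : ℕ → ℂ → ℂ,
    (∀ k, DifferentiableOn ℂ (g k) (ball 0 1) ∧ MapsTo (g k) (ball 0 1) (ball 0 1)) ∧
    WeakConv (fun k => bmeas ((L.f (jk k)) ∘ (g k))) μ ∧
    Tendsto (fun k => L.f (jk k) (g k 0)) atTop (𝓝 z)}

/-- `J_z(L)`: the convex hull of `J_z^s(L)`. -/
def JLSet {n : ℕ} (L : PerfectSeq n) (z : En n) : Set (Measure (En n)) :=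
  {μ | ∃ (m : ℕ) (w : Fin m → ℝ) (ν : Fin m → Measure (En n)),
    (∀ i, 0 ≤ w i) ∧ (∑ i, w i = 1) ∧ (∀ i, ν i ∈ JsSet L z) ∧
    μ = ∑ i, (ENNReal.ofReal (w i)) • ν i}

/-- `u` is harmonic on the totally perfect sequence `L`. -/
def HarmonicOnL {n : ℕ} (L : PerfectSeq n) (u : En n → EReal) : Prop :=
  PSHce (clusterSet L.f) u ∧
  ∀ z ∈ clusterSet L.f, ∀ μ ∈ JLSet L z, eint μ u = u z

/-- `PSH^w(X)`: weakly plurisubharmonic functions, the upper envelopes of nonempty families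
of continuous plurisubharmonic functions on `X`. -/
def PSHw {n : ℕ} (X : Set (En n)) (u : En n → EReal) : Prop :=
  ∃ F : Set (En n → EReal), F.Nonempty ∧ (∀ v ∈ F, PSHce X v) ∧
    ∀ x ∈ X, u x = ⨆ v ∈ F, v x

/-- `u` is maximal on `X ∖ Z`: for every relatively open `V ⊆ X ∖ Z` and every
`v ∈ PSH^c(closure V)`, if `v ≤ u` on the relative boundary of `V` in `X` then `v ≤ u`
on `closure V`. -/
def MaximalOn {n : ℕ} (X Z : Set (En n)) (u : En n → EReal) : Prop :=
  ∀ W : Set (En n), IsOpen W → X ∩ W ⊆ X \ Z →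
    ∀ v : En n → EReal, PSHce (closure (X ∩ W)) v →
      (∀ x ∈ closure (X ∩ W) \ (X ∩ W), v x ≤ u x) →
      ∀ x ∈ closure (X ∩ W), v x ≤ u x

/-- Pluriharmonic continuous real-valued functions on `X`. -/
def Pluriharm {n : ℕ} (X : Set (En n)) (h : En n → ℝ) : Prop :=
  ContinuousOn h X ∧
  ∀ z ∈ X, ∀ μ : Measure (En n), IsJensen X z μ → (h z : EReal) = eint μ (fun x => (h x : EReal))

/-- `X` is a Poisson set: every continuous real-valued function on `B_X` extends to a
pluriharmonic function on `X`. -/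
def PoissonSet {n : ℕ} (X : Set (En n)) : Prop :=
  ∀ φ : En n → ℝ, ContinuousOn φ (Bset X) →
    ∃ h : En n → ℝ, Pluriharm X h ∧ ∀ w ∈ Bset X, h w = φ w

end

theorem epos_coe (r : ℝ) : epos (r : EReal) = ENNReal.ofReal r := by
  simp [epos]

theorem epos_mono : Monotone epos := by
  intro a b hab
  induction b with
  | top => simp [epos]
  | bot => rw [le_bot_iff.mp hab]
  | coe b =>
    induction a with
    | top => simp at hab
    | bot => simp [epos]
    | coe a =>
      rw [epos_coe, epos_coe]
      exact ENNReal.ofReal_le_ofReal (EReal.coe_le_coe_iff.mp hab)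

theorem epos_max (a b : EReal) : epos (max a b) = max (epos a) (epos b) :=
  epos_mono.map_max

theorem epos_neg_max_natCast (a : EReal) (m : ℕ) :
    epos (-(max a (((-(m : ℝ)) : ℝ) : EReal))) = min (epos (-a)) m := by
  have h : -(max a (((-(m : ℝ)) : ℝ) : EReal)) = min (-a) ((m : ℝ) : EReal) := by
    rw [EReal.coe_neg, max_comm, min_comm]
    rcases le_total (-((m : ℝ) : EReal)) a with h | h
    · rw [max_eq_right h, min_eq_right (EReal.neg_le.mp h)]
    · rw [max_eq_left h, min_eq_left (EReal.le_neg_of_le_neg h), neg_neg]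
  rw [h, epos_mono.map_min, epos_coe, ENNReal.ofReal_natCast]

theorem eint_mono_ae {α : Type*} [MeasurableSpace α] {μ : Measure α} {u v : α → EReal}
    (h : ∀ᵐ x ∂μ, u x ≤ v x) : eint μ u ≤ eint μ v := by
  refine EReal.sub_le_sub ?_ ?_
  · exact EReal.coe_ennreal_le_coe_ennreal_iff.mpr
      (lintegral_mono_ae (h.mono fun x hx => epos_mono hx))
  · exact EReal.coe_ennreal_le_coe_ennreal_iff.mpr
      (lintegral_mono_ae (h.mono fun x hx => epos_mono (EReal.neg_le_neg_iff.mpr hx)))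

theorem eint_coe {α : Type*} [MeasurableSpace α] {μ : Measure α} {f : α → ℝ}
    (hf : Integrable f μ) : eint μ (fun x => (f x : EReal)) = ((∫ x, f x ∂μ : ℝ) : EReal) := by
  have h1 : ∫⁻ x, ENNReal.ofReal (f x) ∂μ ≠ ⊤ := hf.lintegral_lt_top.ne
  have h2 : ∫⁻ x, ENNReal.ofReal (-f x) ∂μ ≠ ⊤ := hf.neg.lintegral_lt_top.ne
  rw [integral_eq_lintegral_pos_part_sub_lintegral_neg_part hf, EReal.coe_sub,
    EReal.coe_ennreal_toReal h1, EReal.coe_ennreal_toReal h2]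
  simp only [eint, ← EReal.coe_neg, epos_coe]

/-- Truncating from below a function that is bounded above approximates its integral. -/
theorem tendsto_eint_max {α : Type*} [MeasurableSpace α] {μ : Measure α} {u : α → EReal}
    {f : ℕ → α → ℝ} (hf : ∀ m, Integrable (f m) μ)
    (hfu : ∀ m, ∀ᵐ x ∂μ, (f m x : EReal) = max (u x) ((-(m : ℝ) : ℝ) : EReal)) :
    Tendsto (fun m => ((∫ x, f m x ∂μ : ℝ) : EReal)) atTop (𝓝 (eint μ u)) := by
  have hpos : ∀ m, ∫⁻ x, epos (f m x) ∂μ = ∫⁻ x, epos (u x) ∂μ := fun m =>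
    lintegral_congr_ae ((hfu m).mono fun x hx => by
      beta_reduce
      rw [hx, epos_max, epos_coe, ENNReal.ofReal_of_nonpos (by simp), max_eq_left zero_le])
  have hneg : ∀ m, ∀ᵐ x ∂μ, epos (-(f m x : EReal)) = min (epos (-(u x))) m := fun m =>
    (hfu m).mono fun x hx => by rw [hx, epos_neg_max_natCast]
  have hfin : ∫⁻ x, epos (u x) ∂μ ≠ ⊤ := by
    rw [← hpos 0]
    simp only [epos_coe]
    exact (hf 0).lintegral_lt_top.ne
  have hlim : Tendsto (fun m => ∫⁻ x, epos (-(f m x : EReal)) ∂μ) atTop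
      (𝓝 (∫⁻ x, epos (-(u x)) ∂μ)) := by
    refine lintegral_tendsto_of_tendsto_of_monotone (fun m => ?_) ?_ ?_
    · simp only [← EReal.coe_neg, epos_coe]
      exact (hf m).aemeasurable.neg.ennreal_ofReal
    · filter_upwards [ae_all_iff.mpr hneg] with x hx a b hab
      simp only [hx]
      exact min_le_min le_rfl (by exact_mod_cast hab)
    · filter_upwards [ae_all_iff.mpr hneg] with x hx
      simp only [hx]
      simpa using (tendsto_const_nhds (x := epos (-(u x)))).min ENNReal.tendsto_nat_nhds_top
  simp only [← eint_coe (hf _)]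
  simp only [eint, hpos, sub_eq_add_neg]
  have hlim' : Tendsto (fun m => -((∫⁻ x, epos (-(f m x : EReal)) ∂μ : ℝ≥0∞) : EReal)) atTop
      (𝓝 (-((∫⁻ x, epos (-(u x)) ∂μ : ℝ≥0∞) : EReal))) :=
    (continuous_neg.tendsto _).comp ((continuous_coe_ennreal_ereal.tendsto _).comp hlim)
  exact (EReal.continuousAt_add (p := (_, _)) (Or.inl (mt EReal.coe_ennreal_eq_top_iff.mp hfin))
    (Or.inl (EReal.coe_ennreal_ne_bot _))).tendsto.comp (tendsto_const_nhds.prodMk_nhds hlim')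

theorem exists_bcf_eq_max {E : Type*} [TopologicalSpace E] [T4Space E] {K : Set E}
    (hK : IsCompact K) {u : E → EReal} (hu : ContinuousOn u K) (htop : ∀ x ∈ K, u x < ⊤) (m : ℝ) :
    ∃ φ : BoundedContinuousFunction E ℝ, ∀ x ∈ K, (φ x : EReal) = max (u x) (m : EReal) := by
  have hne_top : ∀ x ∈ K, max (u x) (m : EReal) ≠ ⊤ := fun x hx =>
    (max_lt (htop x hx) (EReal.coe_lt_top m)).ne
  have hne_bot : ∀ x, max (u x) (m : EReal) ≠ ⊥ := fun x =>
    ((EReal.bot_lt_coe m).trans_le (le_max_right _ _)).ne'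
  have hc : ContinuousOn (fun x => (max (u x) (m : EReal)).toReal) K :=
    EReal.continuousOn_toReal.comp (hu.sup continuousOn_const) fun x hx => by
      simp only [mem_compl_iff, mem_insert_iff, mem_singleton_iff, not_or]
      exact ⟨hne_bot x, hne_top x hx⟩
  have : CompactSpace K := isCompact_iff_compactSpace.mp hK
  obtain ⟨φ, -, hφ⟩ := BoundedContinuousFunction.exists_norm_eq_domRestrict_eq_of_closed
    (BoundedContinuousFunction.mkOfCompact ⟨_, hc.domRestrict⟩) hK.isClosed
  refine ⟨φ, fun x hx => ?_⟩
  have := DFunLike.congr_fun hφ ⟨x, hx⟩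
  simp only [BoundedContinuousFunction.domRestrict_apply, BoundedContinuousFunction.mkOfCompact_apply,
    ContinuousMap.coe_mk, Set.domRestrict_apply] at this
  rw [this, EReal.coe_toReal (hne_top x hx) (hne_bot x)]

theorem WeakConv.isProbabilityMeasure {n : ℕ} {μs : ℕ → Measure (En n)} {ν : Measure (En n)}
    (h : WeakConv μs ν) (hμ : ∀ k, IsProbabilityMeasure (μs k)) : IsProbabilityMeasure ν := by
  have h1 := h (BoundedContinuousFunction.const _ 1)
  simp only [BoundedContinuousFunction.const_apply, integral_const, smul_eq_mul, mul_one,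
    probReal_univ] at h1
  have h2 : ν.real univ = 1 := tendsto_nhds_unique h1 tendsto_const_nhds
  exact ⟨by rwa [Measure.real, ENNReal.toReal_eq_one_iff] at h2⟩

theorem WeakConv.measure_compl_eq_zero {n : ℕ} {μs : ℕ → Measure (En n)} {ν : Measure (En n)}
    (h : WeakConv μs ν) [IsFiniteMeasure ν] {K : Set (En n)} (hK : IsClosed K) (hne : K.Nonempty)
    (hμ : ∀ᶠ k in atTop, μs k Kᶜ = 0) : ν Kᶜ = 0 := by
  let φ : BoundedContinuousFunction (En n) ℝ := BoundedContinuousFunction.ofNormedAddCommGroup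
    (fun x => min 1 (infDist x K)) (by fun_prop) 1 fun x => by
      rw [Real.norm_of_nonneg (le_min zero_le_one infDist_nonneg)]
      exact min_le_left _ _
  have hφ0 : ∀ x ∈ K, φ x = 0 := fun x hx => by
    change min 1 (infDist x K) = 0
    simp [infDist_zero_of_mem hx]
  have hlim : Tendsto (fun k => ∫ x, φ x ∂(μs k)) atTop (𝓝 0) :=
    tendsto_const_nhds.congr' <| hμ.mono fun k hk => by
      refine (integral_eq_zero_of_ae ?_).symm
      filter_upwards [mem_ae_iff.mpr hk] with x hx using hφ0 x hx
  have h0 : ∫ x, φ x ∂ν = 0 := tendsto_nhds_unique (h φ) hlim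
  have hnn : 0 ≤ (φ : En n → ℝ) := fun x => le_min zero_le_one infDist_nonneg
  rw [integral_eq_zero_iff_of_nonneg hnn (φ.integrable ν)] at h0
  refine measure_mono_null (fun x hx => ?_) h0
  have hpos : 0 < φ x := lt_min one_pos ((hK.notMem_iff_infDist_pos hne).mp hx)
  exact hpos.ne'

/-- Compactness property of Jensen measures (Lemma 2.1). -/
theorem stmt_0 {n : ℕ} (c : En n) (R : ℝ) (X : ℕ → Set (En n))
    (hcomp : ∀ j, IsCompact (X j)) (hball : ∀ j, X j ⊆ closedBall c R)
    (hdec : Antitone X)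
    (z : ℕ → En n) (hz : ∀ j, z j ∈ X j)
    (μ : ℕ → Measure (En n)) (hμ : ∀ j, IsJensen (X j) (z j) (μ j))
    (jk : ℕ → ℕ) (hjk : StrictMono jk)
    (ν : Measure (En n)) (hν : WeakConv (fun k => μ (jk k)) ν)
    (z0 : En n) (hz0 : Tendsto (fun k => z (jk k)) atTop (𝓝 z0)) :
    IsJensen (⋂ j, X j) z0 ν := by
  obtain hprob := hν.isProbabilityMeasure fun k => (hμ (jk k)).1
  have hsub : ∀ {N k : ℕ}, N ≤ k → X (jk k) ⊆ X N := fun h => hdec (h.trans (hjk.id_le _))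
  have hsupp : ∀ N, ν (X N)ᶜ = 0 := fun N =>
    hν.measure_compl_eq_zero (hcomp N).isClosed ⟨_, hz N⟩ <|
      (eventually_ge_atTop N).mono fun k hk =>
        measure_mono_null (compl_subset_compl.mpr (hsub hk)) (hμ (jk k)).2.1
  refine ⟨hprob, by rw [compl_iInter]; exact measure_iUnion_null hsupp, ?_⟩
  intro U hU hXU u hu hpsh
  obtain ⟨N, hN⟩ := exists_subset_nhds_of_isCompact hdec.directed_ge hcomp
    (fun x hx => hU.mem_nhds (hXU hx))
  have hzmem : ∀ᶠ k in atTop, z (jk k) ∈ X N :=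
    (eventually_ge_atTop N).mono fun k hk => hsub hk (hz _)
  have hz0N : z0 ∈ X N := (hcomp N).isClosed.mem_of_tendsto hz0 hzmem
  choose φ hφ using fun m : ℕ => exists_bcf_eq_max (hcomp N) (hu.mono hN)
    (fun x hx => hpsh.2.1 x (hN hx)) (-(m : ℝ))
  have hule : ∀ m, u z0 ≤ ((∫ x, φ m x ∂ν : ℝ) : EReal) := fun m => by
    have hl : Tendsto (fun k => u (z (jk k))) atTop (𝓝 (u z0)) :=
      (hu.continuousAt (hU.mem_nhds (hN hz0N))).tendsto.comp hz0
    have hr : Tendsto (fun k => ((∫ x, φ m x ∂(μ (jk k)) : ℝ) : EReal)) atTop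
        (𝓝 ((∫ x, φ m x ∂ν : ℝ) : EReal)) :=
      (continuous_coe_real_ereal.tendsto _).comp (hν (φ m))
    refine le_of_tendsto_of_tendsto hl hr ?_
    filter_upwards [eventually_ge_atTop N] with k hk
    obtain ⟨hp, hs, hJ⟩ := hμ (jk k)
    refine (hJ U hU ((hsub hk).trans hN) u hu hpsh).trans ?_
    rw [← eint_coe ((φ m).integrable _)]
    refine eint_mono_ae ?_
    filter_upwards [mem_ae_iff.mpr hs] with x hx
    rw [hφ m x (hsub hk hx)]
    exact le_max_left _ _
  refine ge_of_tendsto' (tendsto_eint_max (fun m => (φ m).integrable ν) fun m => ?_) hule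
  filter_upwards [mem_ae_iff.mpr (hsupp N)] with x hx using hφ m x hx
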